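/- arXiv:1811.12459 — 9 statements merged into one kernel-verified Lean document; each statement's English description precedes it below -/
import Mathlib

section
/- For every δ with 0 < δ < 1/3, there exists a countably infinite sequence of points x₁, x₂, … in [0,1]² such that gap^i_δ > 0 for every i ≥ 2 and the series Σ_{i≥2} gap^i_δ diverges to +∞. -/
open Filter

/-- `rectGap δ x i` : the infimum, over `1 ≤ j < i` and over Rectangle-Shift
perturbations `x̂` of `x i` (each coordinate multiplied by a factor `1 + ε` with
`ε ∈ [0, δ]`), of the dot product `x̂ · (x i − x j)`. -/
noncomputable def rectGap (δ : ℝ) (x : ℕ → ℝ × ℝ) (i : ℕ) : ℝ :=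
  sInf { d : ℝ | ∃ j, 1 ≤ j ∧ j < i ∧ ∃ ε₁ ∈ Set.Icc (0:ℝ) δ, ∃ ε₂ ∈ Set.Icc (0:ℝ) δ,
    d = (x i).1 * (1 + ε₁) * ((x i).1 - (x j).1)
      + (x i).2 * (1 + ε₂) * ((x i).2 - (x j).2) }

/-- The logarithmic weight `1 / (2 ^ n * (n + 1) ^ 2)`, where `n = log₂ k`. -/
noncomputable def logWeight (k : ℕ) : ℝ :=
  1 / (2 ^ Nat.log 2 k * ((Nat.log 2 k : ℝ) + 1) ^ 2)

lemma logWeight_pos (k : ℕ) : 0 < logWeight k := by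
  unfold logWeight; positivity

lemma logWeight_antitone : Antitone logWeight := by
  intro a b hab
  have h : Nat.log 2 a ≤ Nat.log 2 b := Nat.log_mono_right hab
  have h' : (Nat.log 2 a : ℝ) ≤ Nat.log 2 b := by exact_mod_cast h
  unfold logWeight
  have h2 : (2 : ℝ) ^ Nat.log 2 a ≤ 2 ^ Nat.log 2 b := pow_le_pow_right₀ (by norm_num) h
  gcongr

lemma logWeight_le (k : ℕ) : logWeight k ≤ 1 / 2 ^ Nat.log 2 k := by
  unfold logWeight
  have h : (1 : ℝ) ≤ ((Nat.log 2 k : ℝ) + 1) ^ 2 := one_le_pow₀ (by simp)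
  gcongr
  exact le_mul_of_one_le_right (by positivity) h

lemma summable_logWeight : Summable logWeight := by
  rw [← summable_condensed_iff_of_nonneg (fun n => (logWeight_pos n).le)
    (fun _ _ _ h => logWeight_antitone h)]
  have h : Summable fun n : ℕ => 1 / ((n : ℝ) + 1) ^ 2 := by
    have := (summable_nat_add_iff 1).2 (Real.summable_one_div_nat_pow.2 (by norm_num : 1 < 2))
    simpa using this
  refine h.congr fun n => ?_
  simp only [logWeight, Nat.log_pow (by norm_num : 1 < 2)]
  field_simp

lemma one_le_tsum_logWeight : 1 ≤ ∑' k, logWeight k := by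
  have h := summable_logWeight.le_tsum 0 (fun j _ => (logWeight_pos j).le)
  simpa [logWeight] using h

/-- Radii increasing within `[1/2, 1]`, with increments proportional to `logWeight`. -/
noncomputable def shellRadius (i : ℕ) : ℝ :=
  1 / 2 + (∑ k ∈ Finset.range i, logWeight k) / (2 * ∑' k, logWeight k)

lemma half_le_shellRadius (i : ℕ) : 1 / 2 ≤ shellRadius i := by
  have h := one_le_tsum_logWeight
  have h' : 0 ≤ ∑ k ∈ Finset.range i, logWeight k :=
    Finset.sum_nonneg fun k _ => (logWeight_pos k).le
  unfold shellRadius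
  have : 0 ≤ (∑ k ∈ Finset.range i, logWeight k) / (2 * ∑' k, logWeight k) := by positivity
  linarith

lemma shellRadius_le_one (i : ℕ) : shellRadius i ≤ 1 := by
  have h := one_le_tsum_logWeight
  have h' := summable_logWeight.sum_le_tsum (Finset.range i) (fun k _ => (logWeight_pos k).le)
  unfold shellRadius
  have : (∑ k ∈ Finset.range i, logWeight k) / (2 * ∑' k, logWeight k) ≤ 1 / 2 := by
    rw [div_le_iff₀ (by positivity)]
    linarith
  linarith

lemma shellRadius_sub {i j : ℕ} (hij : j ≤ i) :
    ((i : ℝ) - j) * (logWeight i / (2 * ∑' k, logWeight k)) ≤ shellRadius i - shellRadius j := by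
  have h := one_le_tsum_logWeight
  have hsum : ((i : ℝ) - j) * logWeight i ≤ ∑ k ∈ Finset.Ico j i, logWeight k := by
    have := Finset.card_nsmul_le_sum (Finset.Ico j i) logWeight (logWeight i)
      (fun k hk => logWeight_antitone (Finset.mem_Ico.1 hk).2.le)
    simpa [Nat.cast_sub hij] using this
  have heq : shellRadius i - shellRadius j
      = (∑ k ∈ Finset.Ico j i, logWeight k) / (2 * ∑' k, logWeight k) := by
    rw [Finset.sum_Ico_eq_sub _ hij]
    unfold shellRadius
    ring
  rw [heq, ← mul_div_assoc]
  gcongr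

/-- The largest `m ≤ log₂ i / 7` with `2 ^ m ∣ i`. -/
def dirIndex (i : ℕ) : ℕ := Nat.findGreatest (fun m => 2 ^ m ∣ i) (Nat.log 2 i / 7)

lemma two_pow_dirIndex_dvd (i : ℕ) : 2 ^ dirIndex i ∣ i :=
  Nat.findGreatest_spec (P := fun m => 2 ^ m ∣ i) (Nat.zero_le _) (by simp)

lemma dirIndex_le (i : ℕ) : dirIndex i ≤ Nat.log 2 i / 7 := Nat.findGreatest_le _

lemma sum_two_pow_dvd_le (i : ℕ) :
    ∑ k ∈ Finset.range (Nat.log 2 i / 7 + 1), (if 2 ^ k ∣ i then (2 : ℝ) ^ k else 0)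
      ≤ 2 * 2 ^ dirIndex i := by
  rw [← Finset.sum_filter]
  calc _ ≤ ∑ k ∈ Finset.range (dirIndex i + 1), (2 : ℝ) ^ k := by
        refine Finset.sum_le_sum_of_subset_of_nonneg ?_ (fun _ _ _ => by positivity)
        intro k hk
        rw [Finset.mem_filter, Finset.mem_range] at hk
        exact Finset.mem_range.2 (Nat.lt_succ_of_le
          (Nat.le_findGreatest (Nat.le_of_lt_succ hk.1) hk.2))
    _ ≤ 2 * 2 ^ dirIndex i := by
        rw [geom_sum_eq (by norm_num), pow_succ]
        norm_num
        linarith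

lemma two_pow_le_sum_block {n k : ℕ} (hk : k ≤ n) :
    (2 : ℝ) ^ n ≤ ∑ i ∈ Finset.Ico (2 ^ n) (2 ^ (n + 1)),
      (if 2 ^ k ∣ i then (2 : ℝ) ^ k else 0) := by
  obtain ⟨l, rfl⟩ := Nat.exists_eq_add_of_le hk
  have hinj : Function.Injective fun i : ℕ => 2 ^ k * i :=
    fun a b hab => Nat.eq_of_mul_eq_mul_left (by positivity) hab
  calc (2 : ℝ) ^ (k + l)
      = ∑ i ∈ (Finset.Ico (2 ^ l) (2 ^ (l + 1))).image (fun i : ℕ => 2 ^ k * i), (2 : ℝ) ^ k := by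
        rw [Finset.sum_const, Finset.card_image_of_injective _ hinj, Nat.card_Ico,
          show 2 ^ (l + 1) - 2 ^ l = 2 ^ l by rw [pow_succ]; omega, nsmul_eq_mul]
        push_cast
        ring
    _ ≤ _ := by
        rw [← Finset.sum_filter]
        refine Finset.sum_le_sum_of_subset_of_nonneg ?_ (fun _ _ _ => by positivity)
        intro i hi
        obtain ⟨a, ha, rfl⟩ := Finset.mem_image.1 hi
        rw [Finset.mem_Ico] at ha
        rw [Finset.mem_filter, Finset.mem_Ico, add_assoc, pow_add, pow_add 2 k (l + 1)]
        exact ⟨⟨Nat.mul_le_mul_left _ ha.1, Nat.mul_lt_mul_of_pos_left ha.2 (by positivity)⟩,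
          dvd_mul_right _ _⟩

lemma sum_two_pow_dirIndex_block (n : ℕ) :
    ((n : ℝ) + 1) * 2 ^ n / 14 ≤ ∑ i ∈ Finset.Ico (2 ^ n) (2 ^ (n + 1)), (2 : ℝ) ^ dirIndex i := by
  have h1 : ∑ k ∈ Finset.range (n / 7 + 1), (2 : ℝ) ^ n ≤
      ∑ k ∈ Finset.range (n / 7 + 1), ∑ i ∈ Finset.Ico (2 ^ n) (2 ^ (n + 1)),
        (if 2 ^ k ∣ i then (2 : ℝ) ^ k else 0) :=
    Finset.sum_le_sum fun k hk => two_pow_le_sum_block (by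
      have := Finset.mem_range.1 hk
      omega)
  rw [Finset.sum_comm] at h1
  have h2 : ∑ i ∈ Finset.Ico (2 ^ n) (2 ^ (n + 1)), ∑ k ∈ Finset.range (n / 7 + 1),
        (if 2 ^ k ∣ i then (2 : ℝ) ^ k else 0) ≤
      ∑ i ∈ Finset.Ico (2 ^ n) (2 ^ (n + 1)), 2 * (2 : ℝ) ^ dirIndex i := by
    refine Finset.sum_le_sum fun i hi => ?_
    rw [Finset.mem_Ico] at hi
    have hlog : Nat.log 2 i = n := Nat.log_eq_of_pow_le_of_lt_pow hi.1 hi.2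
    simpa only [hlog] using sum_two_pow_dvd_le i
  rw [← Finset.mul_sum] at h2
  rw [Finset.sum_const, Finset.card_range, nsmul_eq_mul] at h1
  have h3 : (n : ℝ) + 1 ≤ 7 * ((n / 7 + 1 : ℕ) : ℝ) := by
    exact_mod_cast (by omega : n + 1 ≤ 7 * (n / 7 + 1))
  have h4 := mul_le_mul_of_nonneg_right h3 (by positivity : (0 : ℝ) ≤ 2 ^ n)
  linarith

/-- Point of radius parameter `r` in the direction of the parabola point of height `v`. -/
noncomputable def parabolaPoint (r v : ℝ) : ℝ × ℝ := (r * (1 - v ^ 2 / 2), r * v)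

/-- The construction: radii `shellRadius i`, directions of heights `(1/8) ^ dirIndex i`. -/
noncomputable def shellPoint (i : ℕ) : ℝ × ℝ :=
  parabolaPoint (shellRadius i) ((1 / 8) ^ dirIndex i)

/-- The perturbed dot product of two points on the parabola whose heights differ by a factor of
at least `8`. -/
lemma parabola_gap {v w ε₁ ε₂ : ℝ} (hv : 0 < v) (hv1 : v ≤ 1) (hw : 0 < w)
    (h : w ≤ v / 8 ∨ 8 * v ≤ w) (h1 : 0 ≤ ε₁) (h1' : ε₁ ≤ 1 / 3) (h2 : 0 ≤ ε₂)
    (h2' : ε₂ ≤ 1 / 3) :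
    v ^ 2 / 8 ≤ (1 - v ^ 2 / 2) * (1 + ε₁) * ((1 - v ^ 2 / 2) - (1 - w ^ 2 / 2))
      + v * (1 + ε₂) * (v - w) := by
  have hu : 1 / 2 ≤ 1 - v ^ 2 / 2 := by nlinarith
  have hu' : 1 - v ^ 2 / 2 ≤ 1 := by nlinarith
  have hA : 1 / 2 ≤ (1 - v ^ 2 / 2) * (1 + ε₁) := by nlinarith
  have hA' : (1 - v ^ 2 / 2) * (1 + ε₁) ≤ 4 / 3 := by nlinarith
  generalize (1 - v ^ 2 / 2) * (1 + ε₁) = A at hA hA'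
  have heq : A * ((1 - v ^ 2 / 2) - (1 - w ^ 2 / 2)) + v * (1 + ε₂) * (v - w)
      = (v - w) * (v * (1 + ε₂) - A * (v + w) / 2) := by ring
  rw [heq]
  rcases h with h | h
  · have h3 : v / 4 ≤ v * (1 + ε₂) - A * (v + w) / 2 := by nlinarith
    have h4 : 7 / 8 * v ≤ v - w := by linarith
    nlinarith [mul_le_mul h4 h3 (by positivity) (by linarith)]
  · have h3 : v / 4 ≤ A * (v + w) / 2 - v * (1 + ε₂) := by nlinarith
    have h4 : 7 * v ≤ w - v := by linarith
    nlinarith [mul_le_mul h4 h3 (by positivity) (by linarith)]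

lemma eighth_pow_separated {m p : ℕ} (h : m ≠ p) :
    ((1 / 8 : ℝ) ^ p ≤ (1 / 8) ^ m / 8) ∨ (8 * (1 / 8 : ℝ) ^ m ≤ (1 / 8) ^ p) := by
  rcases lt_or_gt_of_ne h with h | h
  · left
    have := pow_le_pow_of_le_one (by norm_num : (0 : ℝ) ≤ 1 / 8) (by norm_num)
      (Nat.succ_le_of_lt h)
    rw [pow_succ] at this
    linarith
  · right
    have := pow_le_pow_of_le_one (by norm_num : (0 : ℝ) ≤ 1 / 8) (by norm_num)
      (Nat.succ_le_of_lt h)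
    rw [pow_succ] at this
    linarith

lemma shellPoint_mem (i : ℕ) :
    (shellPoint i).1 ∈ Set.Icc (0 : ℝ) 1 ∧ (shellPoint i).2 ∈ Set.Icc (0 : ℝ) 1 := by
  have hr := half_le_shellRadius i
  have hr' := shellRadius_le_one i
  have hv : (0 : ℝ) < (1 / 8) ^ dirIndex i := by positivity
  have hv' : (1 / 8 : ℝ) ^ dirIndex i ≤ 1 := pow_le_one₀ (by norm_num) (by norm_num)
  unfold shellPoint parabolaPoint
  generalize (1 / 8 : ℝ) ^ dirIndex i = v at hv hv'
  have hu : 0 ≤ 1 - v ^ 2 / 2 := by nlinarith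
  have hu' : 1 - v ^ 2 / 2 ≤ 1 := by nlinarith
  exact ⟨⟨mul_nonneg (by linarith) hu, mul_le_one₀ hr' hu hu'⟩,
    ⟨mul_nonneg (by linarith) hv.le, mul_le_one₀ hr' hv.le hv'⟩⟩

lemma logWeight_div_le_eighth_pow (i : ℕ) :
    2 ^ dirIndex i * (logWeight i / (2 * ∑' k, logWeight k)) ≤ ((1 / 8 : ℝ) ^ dirIndex i) ^ 2 := by
  have hS := one_le_tsum_logWeight
  have h7 : 7 * dirIndex i ≤ Nat.log 2 i := by have := dirIndex_le i; omega
  have hpow : (2 : ℝ) ^ (7 * dirIndex i) ≤ 2 ^ Nat.log 2 i := pow_le_pow_right₀ (by norm_num) h7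
  have hle : logWeight i / (2 * ∑' k, logWeight k) ≤ 1 / 2 ^ (7 * dirIndex i) :=
    calc _ ≤ logWeight i := div_le_self (logWeight_pos i).le (by linarith)
      _ ≤ 1 / 2 ^ Nat.log 2 i := logWeight_le i
      _ ≤ _ := by gcongr
  calc _ ≤ (2 : ℝ) ^ dirIndex i * (1 / 2 ^ (7 * dirIndex i)) := by gcongr
    _ = ((1 / 8 : ℝ) ^ dirIndex i) ^ 2 := by
      rw [pow_mul, ← one_div_pow, ← mul_pow, ← pow_mul, mul_comm _ 2, pow_mul]
      norm_num

/-- In a fixed direction the gap is controlled by the radius increment; across directions it is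
controlled by the square of the height. -/
lemma le_shellPoint_dot {i j : ℕ} (hij : j < i) {ε₁ ε₂ : ℝ} (h1 : 0 ≤ ε₁) (h1' : ε₁ ≤ 1 / 3)
    (h2 : 0 ≤ ε₂) (h2' : ε₂ ≤ 1 / 3) :
    2 ^ dirIndex i * (logWeight i / (2 * ∑' k, logWeight k)) / 32 ≤
      (shellPoint i).1 * (1 + ε₁) * ((shellPoint i).1 - (shellPoint j).1)
      + (shellPoint i).2 * (1 + ε₂) * ((shellPoint i).2 - (shellPoint j).2) := by
  have hS := one_le_tsum_logWeight
  have hr := half_le_shellRadius i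
  have hs := half_le_shellRadius j
  have hsub := shellRadius_sub hij.le
  have hρ : 0 < logWeight i / (2 * ∑' k, logWeight k) :=
    div_pos (logWeight_pos i) (by linarith)
  have hsq := logWeight_div_le_eighth_pow i
  have hv : (0 : ℝ) < (1 / 8) ^ dirIndex i := by positivity
  have hv1 : (1 / 8 : ℝ) ^ dirIndex i ≤ 1 := pow_le_one₀ (by norm_num) (by norm_num)
  have hw : (0 : ℝ) < (1 / 8) ^ dirIndex j := by positivity
  have hij' : (0 : ℝ) < (i : ℝ) - j := by
    have : (j : ℝ) < i := by exact_mod_cast hij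
    linarith
  have hrs : 0 ≤ shellRadius i - shellRadius j :=
    le_trans (mul_nonneg hij'.le hρ.le) hsub
  unfold shellPoint parabolaPoint
  by_cases hm : dirIndex i = dirIndex j
  · have hdvd : 2 ^ dirIndex i ∣ i - j :=
      Nat.dvd_sub (two_pow_dirIndex_dvd i) (hm ▸ two_pow_dirIndex_dvd j)
    have hle : (2 : ℝ) ^ dirIndex i ≤ (i : ℝ) - j := by
      rw [← Nat.cast_sub hij.le]
      exact_mod_cast Nat.le_of_dvd (by omega) hdvd
    have hρle := (mul_le_mul_of_nonneg_right hle hρ.le).trans hsub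
    rw [← hm]
    generalize (1 / 8 : ℝ) ^ dirIndex i = v at *
    generalize 2 ^ dirIndex i * (logWeight i / (2 * ∑' k, logWeight k)) = t at *
    generalize shellRadius i = r at *
    generalize shellRadius j = s at *
    have hu : 1 / 2 ≤ 1 - v ^ 2 / 2 := by nlinarith
    have hA : 1 / 4 ≤ (1 - v ^ 2 / 2) ^ 2 * (1 + ε₁) + v ^ 2 * (1 + ε₂) := by
      nlinarith [sq_nonneg v, mul_nonneg (sq_nonneg v) h2,
        mul_nonneg (sq_nonneg (1 - v ^ 2 / 2)) h1]
    calc t / 32 ≤ (1 / 2 * (r - s)) * (1 / 4) := by linarith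
      _ ≤ (r * (r - s)) * ((1 - v ^ 2 / 2) ^ 2 * (1 + ε₁) + v ^ 2 * (1 + ε₂)) := by gcongr
      _ = _ := by ring
  · have hG := parabola_gap hv hv1 hw (eighth_pow_separated hm) h1 h1' h2 h2'
    generalize (1 / 8 : ℝ) ^ dirIndex i = v at *
    generalize (1 / 8 : ℝ) ^ dirIndex j = w at *
    generalize 2 ^ dirIndex i * (logWeight i / (2 * ∑' k, logWeight k)) = t at *
    generalize shellRadius i = r at *
    generalize shellRadius j = s at *
    have hN : 0 ≤ r * (r - s) * ((1 - v ^ 2 / 2) ^ 2 * (1 + ε₁) + v ^ 2 * (1 + ε₂)) := by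
      have : 0 ≤ r := by linarith
      positivity
    calc t / 32 ≤ (1 / 2 * (1 / 2)) * (v ^ 2 / 8) := by linarith
      _ ≤ (r * s) * ((1 - v ^ 2 / 2) * (1 + ε₁) * ((1 - v ^ 2 / 2) - (1 - w ^ 2 / 2))
          + v * (1 + ε₂) * (v - w)) := by gcongr
      _ ≤ _ := by linarith

lemma le_rectGap_shellPoint {δ : ℝ} (hδ0 : 0 ≤ δ) (hδ : δ ≤ 1 / 3) {i : ℕ} (hi : 2 ≤ i) :
    2 ^ dirIndex i * (logWeight i / (2 * ∑' k, logWeight k)) / 32 ≤ rectGap δ shellPoint i := by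
  refine le_csInf ⟨_, 1, le_rfl, hi, 0, ⟨le_rfl, hδ0⟩, 0, ⟨le_rfl, hδ0⟩, rfl⟩ ?_
  rintro d ⟨j, -, hj, ε₁, h1, ε₂, h2, rfl⟩
  exact le_shellPoint_dot hj h1.1 (h1.2.trans hδ) h2.1 (h2.2.trans hδ)

lemma rectGap_shellPoint_pos {δ : ℝ} (hδ0 : 0 ≤ δ) (hδ : δ ≤ 1 / 3) {i : ℕ} (hi : 2 ≤ i) :
    0 < rectGap δ shellPoint i := by
  refine lt_of_lt_of_le ?_ (le_rectGap_shellPoint hδ0 hδ hi)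
  have := one_le_tsum_logWeight
  have := logWeight_pos i
  positivity

lemma sum_rectGap_block {δ : ℝ} (hδ0 : 0 ≤ δ) (hδ : δ ≤ 1 / 3) {n : ℕ} (hn : 1 ≤ n) :
    1 / (896 * ∑' k, logWeight k) * (1 / ((n : ℝ) + 1)) ≤
      ∑ i ∈ Finset.Ico (2 ^ n) (2 ^ (n + 1)), rectGap δ shellPoint i := by
  have hS := one_le_tsum_logWeight
  have hS0 : 0 < ∑' k, logWeight k := by linarith
  calc 1 / (896 * ∑' k, logWeight k) * (1 / ((n : ℝ) + 1))
      = (((n : ℝ) + 1) * 2 ^ n / 14) *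
          (1 / (2 ^ n * ((n : ℝ) + 1) ^ 2) / (2 * ∑' k, logWeight k) / 32) := by
        field_simp
        norm_num
    _ ≤ (∑ i ∈ Finset.Ico (2 ^ n) (2 ^ (n + 1)), (2 : ℝ) ^ dirIndex i) *
          (1 / (2 ^ n * ((n : ℝ) + 1) ^ 2) / (2 * ∑' k, logWeight k) / 32) := by
        gcongr
        exact sum_two_pow_dirIndex_block n
    _ ≤ _ := by
        rw [Finset.sum_mul]
        refine Finset.sum_le_sum fun i hi => ?_
        rw [Finset.mem_Ico] at hi
        have hlog : Nat.log 2 i = n := Nat.log_eq_of_pow_le_of_lt_pow hi.1 hi.2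
        have h2 : 2 ≤ i := (Nat.le_self_pow (by omega) 2).trans hi.1
        have h := le_rectGap_shellPoint hδ0 hδ h2
        rw [mul_div_assoc] at h
        simpa only [logWeight, hlog] using h

lemma tendsto_sum_Ico_rectGap {δ : ℝ} (hδ0 : 0 ≤ δ) (hδ : δ ≤ 1 / 3) :
    Tendsto (fun n => ∑ i ∈ Finset.Ico 2 n, rectGap δ shellPoint i) atTop atTop := by
  have hS := one_le_tsum_logWeight
  have hmono : Monotone fun n => ∑ i ∈ Finset.Ico 2 n, rectGap δ shellPoint i := by
    intro a b hab
    exact Finset.sum_le_sum_of_subset_of_nonneg (Finset.Ico_subset_Ico_right hab)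
      fun i hi _ => (rectGap_shellPoint_pos hδ0 hδ (Finset.mem_Ico.1 hi).1).le
  have hblocks : ∀ N : ℕ, 1 / (896 * ∑' k, logWeight k) *
      ∑ n ∈ Finset.range N, 1 / (((n + 1 : ℕ) : ℝ) + 1) ≤
        ∑ i ∈ Finset.Ico 2 (2 ^ (N + 1)), rectGap δ shellPoint i := by
    intro N
    induction N with
    | zero => simp
    | succ N ih =>
      rw [Finset.sum_range_succ, mul_add,
        ← Finset.sum_Ico_consecutive _ (Nat.le_self_pow (by omega) 2 : 2 ≤ 2 ^ (N + 1))
          (Nat.pow_le_pow_right (by norm_num) (Nat.le_succ (N + 1)))]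
      exact add_le_add ih (sum_rectGap_block hδ0 hδ (Nat.le_add_left 1 N))
  have hharm : Tendsto (fun N => ∑ n ∈ Finset.range N, 1 / (((n + 1 : ℕ) : ℝ) + 1))
      atTop atTop := by
    rw [← not_summable_iff_tendsto_nat_atTop_of_nonneg (fun n => by positivity)]
    have h := mt (summable_nat_add_iff (f := fun n : ℕ => 1 / (n : ℝ)) 2).1
      Real.not_summable_one_div_natCast
    refine mt (fun h' => h'.congr fun n => ?_) h
    push_cast
    ring
  refine tendsto_atTop_atTop_of_monotone hmono fun b => ?_
  have hlim := tendsto_atTop_mono hblocks (hharm.const_mul_atTop (by positivity))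
  obtain ⟨N, hN⟩ := (hlim.eventually_ge_atTop b).exists
  exact ⟨_, hN⟩

/-- For every `0 < δ < 1/3` there is a countably infinite sequence of points in `[0,1]²`
whose gaps are positive (for `i ≥ 2`) and whose gap series diverges to `+∞`. -/
theorem stmt0 (δ : ℝ) (hδ0 : 0 < δ) (hδ : δ < 1/3) :
    ∃ x : ℕ → ℝ × ℝ,
      (∀ i, 1 ≤ i → (x i).1 ∈ Set.Icc (0:ℝ) 1 ∧ (x i).2 ∈ Set.Icc (0:ℝ) 1) ∧
      (∀ i, 2 ≤ i → 0 < rectGap δ x i) ∧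
      Tendsto (fun n => ∑ i ∈ Finset.Icc 2 n, rectGap δ x i) atTop atTop :=
  ⟨shellPoint, fun i _ => shellPoint_mem i,
    fun _ hi => rectGap_shellPoint_pos hδ0.le hδ.le hi,
    (tendsto_sum_Ico_rectGap hδ0.le hδ.le).comp (tendsto_add_atTop_nat 1)⟩
end

section
/- Let δ ≥ 0, r > 0, θ ∈ [0, π/2], and let x̂ = (r cos θ · (1+ε₁), r sin θ · (1+ε₂)) for some ε₁, ε₂ ∈ [0, δ]. If θ̂ ∈ [0, π/2] and ρ > 0 are such that x̂ = (ρ cos θ̂, ρ sin θ̂), then |θ̂ − θ| ≤ δ·θ. -/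
theorem le_mul_of_sin_mul_cos_le {a b c : ℝ} (ha : 0 ≤ a)
    (hb' : b ≤ Real.pi / 2) (hc : 1 ≤ c)
    (h : Real.sin b * Real.cos a ≤ c * (Real.sin a * Real.cos b)) : b ≤ c * a := by
  by_contra! hlt
  have hab : a < b := by nlinarith
  have hcosb : 0 ≤ Real.cos b := Real.cos_nonneg_of_mem_Icc ⟨by linarith, hb'⟩
  have hsub : Real.sin (b - a) ≤ (c - 1) * Real.sin a * Real.cos b := by
    rw [Real.sin_sub]
    linarith
  have hsin : 0 < Real.sin (b - a) :=
    Real.sin_pos_of_pos_of_lt_pi (by linarith) (by linarith [Real.pi_pos])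
  rcases ha.eq_or_lt with rfl | ha
  · simp at hsub hsin
    linarith
  have htan : b - a < Real.tan (b - a) := Real.lt_tan (by linarith) (by linarith)
  have hcos : 0 < Real.cos (b - a) := Real.cos_pos_of_mem_Ioo ⟨by linarith, by linarith⟩
  rw [Real.tan_eq_sin_div_cos, lt_div_iff₀ hcos] at htan
  have hmono : Real.cos b ≤ Real.cos (b - a) :=
    Real.cos_le_cos_of_nonneg_of_le_pi (by linarith) (by linarith [Real.pi_pos]) (by linarith)
  have hle : (c - 1) * Real.sin a ≤ b - a := by
    nlinarith [Real.sin_le ha.le]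
  have h₁ := mul_le_mul_of_nonneg_right hle hcosb
  have h₂ := mul_le_mul_of_nonneg_left hmono (sub_nonneg.2 hab.le)
  linarith

/-- A Rectangle-Shift perturbation (each coordinate multiplied by a factor in `[1, 1+δ]`)
changes the polar angle of a point by at most a `δ` multiplicative factor. -/
theorem stmt2 (δ : ℝ) (hδ : 0 ≤ δ) (r : ℝ) (hr : 0 < r)
    (θ : ℝ) (hθ : θ ∈ Set.Icc 0 (Real.pi/2))
    (ε₁ ε₂ : ℝ) (hε₁ : ε₁ ∈ Set.Icc 0 δ) (hε₂ : ε₂ ∈ Set.Icc 0 δ)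
    (θh ρ : ℝ) (hθh : θh ∈ Set.Icc 0 (Real.pi/2)) (hρ : 0 < ρ)
    (h1 : ρ * Real.cos θh = r * Real.cos θ * (1 + ε₁))
    (h2 : ρ * Real.sin θh = r * Real.sin θ * (1 + ε₂)) :
    |θh - θ| ≤ δ * θ := by
  obtain ⟨hθ0, hθ1⟩ := hθ
  obtain ⟨hφ0, hφ1⟩ := hθh
  obtain ⟨h₁0, h₁δ⟩ := hε₁
  obtain ⟨h₂0, h₂δ⟩ := hε₂
  have hpi := Real.pi_pos
  have hX : 0 ≤ Real.sin θh * Real.cos θ :=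
    mul_nonneg (Real.sin_nonneg_of_nonneg_of_le_pi hφ0 (by linarith))
      (Real.cos_nonneg_of_mem_Icc ⟨by linarith, hθ1⟩)
  have hY : 0 ≤ Real.sin θ * Real.cos θh :=
    mul_nonneg (Real.sin_nonneg_of_nonneg_of_le_pi hθ0 (by linarith))
      (Real.cos_nonneg_of_mem_Icc ⟨by linarith, hφ1⟩)
  have hXY : (1 + ε₁) * (Real.sin θh * Real.cos θ) = (1 + ε₂) * (Real.sin θ * Real.cos θh) := by
    apply mul_left_cancel₀ (mul_pos hρ hr).ne'
    linear_combination (r * Real.cos θ * (1 + ε₁)) * h2 - (r * Real.sin θ * (1 + ε₂)) * h1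
  have hupper : θh ≤ (1 + δ) * θ :=
    le_mul_of_sin_mul_cos_le hθ0 hφ1 (by linarith) (by nlinarith)
  have hlower : θ ≤ (1 + δ) * θh :=
    le_mul_of_sin_mul_cos_le hφ0 hθ1 (by linarith) (by nlinarith)
  rw [abs_le]
  constructor
  · nlinarith
  · linarith
end

section
/- For every δ ≥ 0 and every θ ∈ [0, π/2), arctan((1+δ)·tan θ) − θ ≤ δ · sin θ · cos θ; in particular arctan((1+δ)·tan θ) − θ ≤ δ·θ. -/
theorem arctan_sub_arctan_le_div {x y : ℝ} (hx : 0 ≤ x) (hxy : x ≤ y) :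
    Real.arctan y - Real.arctan x ≤ (y - x) / (1 + x ^ 2) := by
  have h := (convex_Icc x y).image_sub_le_mul_sub_of_deriv_le
    Real.continuous_arctan.continuousOn Real.differentiable_arctan.differentiableOn
    (C := 1 / (1 + x ^ 2)) (fun z hz => by
      rw [interior_Icc] at hz
      rw [Real.deriv_arctan]
      exact one_div_le_one_div_of_le (by positivity) (by gcongr; exact hz.1.le))
    x ⟨le_rfl, hxy⟩ y ⟨hxy, le_rfl⟩ hxy
  rwa [one_div_mul_eq_div] at h

/-- For `δ ≥ 0` and `θ ∈ [0, π/2)`,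
`arctan((1+δ)·tan θ) − θ ≤ δ·sin θ·cos θ`, and in particular it is at most `δ·θ`. -/
theorem stmt3 (δ : ℝ) (hδ : 0 ≤ δ) (θ : ℝ) (hθ : θ ∈ Set.Ico 0 (Real.pi/2)) :
    Real.arctan ((1+δ) * Real.tan θ) - θ ≤ δ * Real.sin θ * Real.cos θ ∧
    Real.arctan ((1+δ) * Real.tan θ) - θ ≤ δ * θ := by
  obtain ⟨h0, h1⟩ := hθ
  have hcos : 0 < Real.cos θ := Real.cos_pos_of_mem_Ioo ⟨by linarith, h1⟩
  have htan : 0 ≤ Real.tan θ := Real.tan_nonneg_of_nonneg_of_le_pi_div_two h0 h1.le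
  have key : Real.arctan ((1+δ) * Real.tan θ) - θ ≤ δ * Real.sin θ * Real.cos θ := by
    have h := arctan_sub_arctan_le_div htan
      (show Real.tan θ ≤ (1+δ) * Real.tan θ by nlinarith [mul_nonneg hδ htan])
    rw [Real.arctan_tan (by linarith) h1, div_eq_mul_inv, Real.inv_one_add_tan_sq hcos.ne'] at h
    refine h.trans_eq ?_
    rw [← Real.tan_mul_cos hcos.ne']
    ring
  refine ⟨key, key.trans ?_⟩
  rw [mul_assoc]
  gcongr
  calc Real.sin θ * Real.cos θ ≤ θ * 1 := by
        gcongr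
        · exact Real.sin_le h0
        · exact Real.cos_le_one θ
    _ = θ := mul_one θ
end

section
/- For every δ ≥ 0 and every θ ∈ [0, π/2), θ − arctan(tan θ / (1+δ)) ≤ δ·θ. -/
/-- The map `t ↦ (1 - δ) arctan t - arctan (t / (1 + δ))` is antitone for `δ ≥ 0`. -/
theorem antitone_arctan_sub_arctan_div {δ : ℝ} (hδ : 0 ≤ δ) :
    Antitone fun t : ℝ ↦ (1 - δ) * Real.arctan t - Real.arctan (t / (1 + δ)) := by
  have hderiv (t : ℝ) : HasDerivAt
      (fun t : ℝ ↦ (1 - δ) * Real.arctan t - Real.arctan (t / (1 + δ)))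
      ((1 - δ) * (1 / (1 + t ^ 2)) - 1 / (1 + (t / (1 + δ)) ^ 2) * (1 / (1 + δ))) t :=
    ((Real.hasDerivAt_arctan t).const_mul (1 - δ)).sub
      ((hasDerivAt_id t).div_const (1 + δ)).arctan
  refine antitone_of_hasDerivAt_nonpos hderiv fun t ↦ ?_
  have hc : 0 < 1 + δ := by linarith
  have heq : 1 / (1 + (t / (1 + δ)) ^ 2) * (1 / (1 + δ)) =
      (1 + δ) / ((1 + δ) ^ 2 + t ^ 2) := by
    field_simp
  rw [Pi.zero_apply, heq, mul_one_div, sub_nonpos, div_le_div_iff₀ (by positivity) (by positivity)]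
  nlinarith [mul_nonneg hδ (sq_nonneg t), mul_nonneg hc.le (sq_nonneg δ)]

/-- For `δ ≥ 0` and `θ ∈ [0, π/2)`, `θ − arctan(tan θ / (1+δ)) ≤ δ·θ`. -/
theorem stmt4 (δ : ℝ) (hδ : 0 ≤ δ) (θ : ℝ) (hθ : θ ∈ Set.Ico 0 (Real.pi/2)) :
    θ - Real.arctan (Real.tan θ / (1+δ)) ≤ δ * θ := by
  have h := antitone_arctan_sub_arctan_div hδ
    (Real.tan_nonneg_of_nonneg_of_le_pi_div_two hθ.1 hθ.2.le)
  simp only [Real.arctan_tan (by linarith [hθ.1, Real.pi_pos]) hθ.2, zero_div,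
    Real.arctan_zero, mul_zero, sub_zero] at h
  linarith
end

section
/- Let δ > 0 and ℓ > 0. Let θ_i, θ_j, θ̂ ∈ [0, π/2] satisfy |θ̂ − θ_i| ≤ δ·θ_i and |θ_i − θ_j| ≥ 3δ·θ_i, and let ρ ≥ ℓ. Set x_i = ℓ(cos θ_i, sin θ_i), x_j = ℓ(cos θ_j, sin θ_j), and x̂ = ρ(cos θ̂, sin θ̂). Then the dot product x̂ · (x_i − x_j) ≥ (2/π²)·ℓ²·δ²·θ_i². -/
/-- Jordan's inequality applied to `cos d - cos (2 * d) = 2 * sin (3 * d / 2) * sin (d / 2)`. -/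
lemma two_div_pi_sq_mul_sq_le_cos_sub_cos_two_mul {d : ℝ} (h0 : 0 ≤ d) (hd : d ≤ Real.pi / 4) :
    2 / Real.pi ^ 2 * d ^ 2 ≤ Real.cos d - Real.cos (2 * d) := by
  have hπ := Real.pi_pos
  have hs₁ : 2 / Real.pi * (3 * d / 2) ≤ Real.sin (3 * d / 2) :=
    Real.mul_le_sin (by linarith) (by linarith)
  have hs₂ : 2 / Real.pi * (d / 2) ≤ Real.sin (d / 2) :=
    Real.mul_le_sin (by linarith) (by linarith)
  have hprod := mul_le_mul hs₁ hs₂ (by positivity) (le_trans (by positivity) hs₁)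
  have hcos : Real.cos d - Real.cos (2 * d) = 2 * (Real.sin (3 * d / 2) * Real.sin (d / 2)) := by
    rw [Real.cos_sub_cos, show (d + 2 * d) / 2 = 3 * d / 2 by ring,
      show (d - 2 * d) / 2 = -(d / 2) by ring, Real.sin_neg]
    ring
  have hsq : 2 / Real.pi * (3 * d / 2) * (2 / Real.pi * (d / 2)) = 3 * (d ^ 2 / Real.pi ^ 2) := by
    field_simp
  have hnonneg : 0 ≤ d ^ 2 / Real.pi ^ 2 := by positivity
  rw [hcos, div_mul_eq_mul_div, mul_div_assoc]
  linarith

/-- If `θ̂` is within `δ·θ_i` of `θ_i` and `θ_j` is at least `3δ·θ_i` away from `θ_i`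
(all angles in `[0, π/2]`), then for `x_i = ℓ(cos θ_i, sin θ_i)`,
`x_j = ℓ(cos θ_j, sin θ_j)` and `x̂ = ρ(cos θ̂, sin θ̂)` with `ρ ≥ ℓ`,
the dot product `x̂ · (x_i − x_j)` is at least `(2/π²)·ℓ²·δ²·θ_i²`. -/
theorem stmt5 (δ ℓ : ℝ) (hδ : 0 < δ) (hℓ : 0 < ℓ)
    (θi θj θh : ℝ) (hθi : θi ∈ Set.Icc 0 (Real.pi/2)) (hθj : θj ∈ Set.Icc 0 (Real.pi/2))
    (hθh : θh ∈ Set.Icc 0 (Real.pi/2))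
    (h1 : |θh - θi| ≤ δ * θi) (h2 : 3 * δ * θi ≤ |θi - θj|)
    (ρ : ℝ) (hρ : ℓ ≤ ρ) :
    2 / Real.pi^2 * ℓ^2 * δ^2 * θi^2 ≤
      ρ * Real.cos θh * (ℓ * Real.cos θi - ℓ * Real.cos θj)
      + ρ * Real.sin θh * (ℓ * Real.sin θi - ℓ * Real.sin θj) := by
  obtain ⟨hi0, hi1⟩ := hθi
  obtain ⟨hj0, hj1⟩ := hθj
  obtain ⟨hh0, hh1⟩ := hθh
  have hπ := Real.pi_pos
  have hd0 : 0 ≤ δ * θi := by positivity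
  have hfar : 2 * (δ * θi) ≤ |θh - θj| := by
    have := abs_sub_le θi θh θj
    rw [abs_sub_comm θi θh] at this
    linarith
  have hle : |θh - θj| ≤ Real.pi / 2 := abs_le.mpr ⟨by linarith, by linarith⟩
  have hnear_cos : Real.cos (δ * θi) ≤ Real.cos (θh - θi) := by
    rw [← Real.cos_abs (θh - θi)]
    exact Real.cos_le_cos_of_nonneg_of_le_pi (abs_nonneg _) (by linarith) h1
  have hfar_cos : Real.cos (θh - θj) ≤ Real.cos (2 * (δ * θi)) := by
    rw [← Real.cos_abs (θh - θj)]
    exact Real.cos_le_cos_of_nonneg_of_le_pi (by linarith) (by linarith) hfar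
  have hgap : 2 / Real.pi ^ 2 * (δ * θi) ^ 2 ≤ Real.cos (θh - θi) - Real.cos (θh - θj) := by
    linarith [two_div_pi_sq_mul_sq_le_cos_sub_cos_two_mul hd0 (by linarith)]
  calc 2 / Real.pi ^ 2 * ℓ ^ 2 * δ ^ 2 * θi ^ 2
      = ℓ * ℓ * (2 / Real.pi ^ 2 * (δ * θi) ^ 2) := by ring
    _ ≤ ρ * ℓ * (Real.cos (θh - θi) - Real.cos (θh - θj)) := by
        have : 0 ≤ ρ := hℓ.le.trans hρ
        gcongr
    _ = _ := by
        rw [Real.cos_sub, Real.cos_sub]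
        ring
end

section
/- Let δ > 0, θ ∈ [0, π/2], and a, b ≥ 0 with (a,b) ≠ (0,0). Define S = { r > 0 : (r cos θ, r sin θ) is a Square-Shift perturbation of (a,b) }. Then the Lebesgue integral ∫₀^∞ (1/r)·1_S(r) dr ≤ ln(1+δ). -/
/-- `sqShift2 δ a b x y` : `(x, y)` is a Square-Shift perturbation of `(a, b)`. -/
def sqShift2 (δ a b x y : ℝ) : Prop :=
  ∃ ε₁ ∈ Set.Icc (0:ℝ) δ, ∃ ε₂ ∈ Set.Icc (0:ℝ) δ,
    x = a + ε₁ * max a b ∧ y = b + ε₂ * max a b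

open MeasureTheory in
lemma lintegral_Icc_one_div {m n : ℝ} (hm : 0 < m) (hmn : m ≤ n) :
    ∫⁻ r in Set.Icc m n, ENNReal.ofReal (1 / r) = ENNReal.ofReal (Real.log (n / m)) := by
  have hint : IntegrableOn (fun r : ℝ => 1 / r) (Set.Icc m n) :=
    (continuousOn_const.div continuousOn_id
      fun x hx => (hm.trans_le hx.1).ne').integrableOn_Icc
  rw [← integral_one_div_of_pos hm (hm.trans_le hmn), intervalIntegral.integral_of_le hmn,
    ← integral_Icc_eq_integral_Ioc, ofReal_integral_eq_lintegral_ofReal hint]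
  filter_upwards [ae_restrict_mem measurableSet_Icc] with x hx
  exact one_div_nonneg.2 (hm.le.trans hx.1)

/-- If `r * c` stays within a factor `1 + δ` above `M > 0` on `S`, then `∫ 1/r` over `S`
is at most `log (1 + δ)`. -/
lemma lintegral_indicator_one_div_le {δ M c : ℝ} (hδ : 0 ≤ δ) (hM : 0 < M) (hc : 0 ≤ c)
    {S : Set ℝ} (hS : ∀ r ∈ S, r * c ∈ Set.Icc M ((1 + δ) * M)) :
    ∫⁻ r in Set.Ioi (0 : ℝ), S.indicator (fun r => ENNReal.ofReal (1 / r)) r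
      ≤ ENNReal.ofReal (Real.log (1 + δ)) := by
  rcases hc.eq_or_lt with rfl | hc
  · have hempty : S = ∅ := Set.eq_empty_of_forall_notMem fun r hr => by
      have := (hS r hr).1
      rw [mul_zero] at this
      exact hM.not_ge this
    simp [hempty]
  · have hm : 0 < M / c := div_pos hM hc
    have hsub : S ⊆ Set.Icc (M / c) ((1 + δ) * (M / c)) := fun r hr =>
      ⟨(div_le_iff₀ hc).2 (hS r hr).1, by
        rw [← mul_div_assoc]
        exact (le_div_iff₀ hc).2 (hS r hr).2⟩
    calc ∫⁻ r in Set.Ioi (0 : ℝ), S.indicator (fun r => ENNReal.ofReal (1 / r)) r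
        ≤ ∫⁻ r, S.indicator (fun r => ENNReal.ofReal (1 / r)) r :=
          MeasureTheory.setLIntegral_le_lintegral _ _
      _ ≤ ∫⁻ r, (Set.Icc (M / c) ((1 + δ) * (M / c))).indicator
            (fun r => ENNReal.ofReal (1 / r)) r :=
          MeasureTheory.lintegral_mono
            (Set.indicator_le_indicator_of_subset hsub fun _ => zero_le)
      _ = ENNReal.ofReal (Real.log (1 + δ)) := by
          rw [MeasureTheory.lintegral_indicator measurableSet_Icc,
            lintegral_Icc_one_div hm (by nlinarith), mul_div_cancel_right₀ _ hm.ne']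

/-- The set `S` of radii `r > 0` for which `(r cos θ, r sin θ)` is a Square-Shift
perturbation of `(a, b) ≠ (0, 0)` satisfies `∫₀^∞ (1/r)·1_S(r) dr ≤ ln(1+δ)`. -/
theorem stmt10 (δ : ℝ) (hδ : 0 < δ) (θ : ℝ) (hθ : θ ∈ Set.Icc 0 (Real.pi/2))
    (a b : ℝ) (ha : 0 ≤ a) (hb : 0 ≤ b) (hab : (a, b) ≠ ((0:ℝ), (0:ℝ))) :
    ∫⁻ r in Set.Ioi (0:ℝ),
        Set.indicator {r : ℝ | 0 < r ∧ sqShift2 δ a b (r * Real.cos θ) (r * Real.sin θ)}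
          (fun r => ENNReal.ofReal (1/r)) r
      ≤ ENNReal.ofReal (Real.log (1+δ)) := by
  have hpi := Real.pi_pos
  have hM : 0 < max a b := by
    by_contra! h
    obtain ⟨h₁, h₂⟩ := max_le_iff.1 h
    exact hab (Prod.ext (h₁.antisymm ha) (h₂.antisymm hb))
  rcases le_total b a with h | h
  · rw [max_eq_left h] at hM
    refine lintegral_indicator_one_div_le hδ.le hM
      (Real.cos_nonneg_of_mem_Icc ⟨by linarith [hθ.1], hθ.2⟩) ?_
    rintro r ⟨-, ε₁, hε, -, -, hx, -⟩
    rw [hx, max_eq_left h]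
    constructor <;> nlinarith [hε.1, hε.2]
  · rw [max_eq_right h] at hM
    refine lintegral_indicator_one_div_le hδ.le hM
      (Real.sin_nonneg_of_nonneg_of_le_pi hθ.1 (by linarith [hθ.2])) ?_
    rintro r ⟨-, -, -, ε₂, hε, -, hy⟩
    rw [hy, max_eq_right h]
    constructor <;> nlinarith [hε.1, hε.2]
end

section
/- Let m ≥ 1 and δ > 0. Let u ∈ ℝ^m have nonnegative coordinates with ‖u‖₂ = 1, and let v ∈ ℝ^m have nonnegative coordinates with v ≠ 0. Define S = { r > 0 : r·u is a Square-Shift perturbation of v }. Then the Lebesgue integral ∫₀^∞ (1/r)·1_S(r) dr ≤ ln(1+δ). -/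
/-- `sqShift δ v vhat` : `vhat` is a Square-Shift perturbation of `v`. -/
def sqShift {m : ℕ} (δ : ℝ) (v vhat : EuclideanSpace ℝ (Fin m)) : Prop :=
  ∃ ε : Fin m → ℝ, (∀ j, ε j ∈ Set.Icc (0:ℝ) δ) ∧
    ∀ j, vhat j = v j + ε j * (⨆ k, v k)

open MeasureTheory in
/-- The logarithmic length of `[a, a * c]` is `log c`. -/
theorem setLIntegral_Icc_one_div_eq_log {a c : ℝ} (ha : 0 < a) (hc : 1 ≤ c) :
    ∫⁻ r in Set.Icc a (a * c), ENNReal.ofReal (1 / r) = ENNReal.ofReal (Real.log c) := by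
  have hac : a ≤ a * c := le_mul_of_one_le_right ha.le hc
  have hint : IntegrableOn (fun r : ℝ => 1 / r) (Set.Icc a (a * c)) :=
    ContinuousOn.integrableOn_Icc <|
      continuousOn_const.div continuousOn_id fun r hr => (ha.trans_le hr.1).ne'
  rw [← ofReal_integral_eq_lintegral_ofReal hint, integral_Icc_eq_integral_Ioc,
    ← intervalIntegral.integral_of_le hac, integral_one_div_of_pos ha (ha.trans_le hac),
    mul_div_cancel_left₀ c ha.ne']
  filter_upwards [ae_restrict_mem measurableSet_Icc] with r hr
  exact one_div_nonneg.2 (ha.le.trans hr.1)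

/-- The radii at which a ray meets the perturbations of a nonnegative nonzero `v` lie in an
interval of multiplicative spread `1 + δ`. -/
theorem exists_sqShift_radii_subset_Icc {m : ℕ} (δ : ℝ) (u v : EuclideanSpace ℝ (Fin m))
    (hu : ∀ j, 0 ≤ u j) (hv : ∀ j, 0 ≤ v j) (hv0 : v ≠ 0) :
    ∃ a : ℝ, 0 < a ∧ {r : ℝ | 0 < r ∧ sqShift δ v (r • u)} ⊆ Set.Icc a (a * (1 + δ)) := by
  obtain ⟨i, hi⟩ : ∃ i, v i ≠ 0 := by
    by_contra! h
    exact hv0 (by ext i; simpa using h i)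
  have : Nonempty (Fin m) := ⟨i⟩
  obtain ⟨k, hk⟩ := exists_eq_ciSup_of_finite (f := fun k => v k)
  have hpos : 0 < v k := by
    have h : v i ≤ ⨆ k, v k := le_ciSup (f := fun k => v k) (Set.finite_range _).bddAbove i
    exact ((hv i).lt_of_ne' hi).trans_le (h.trans_eq hk.symm)
  rcases (hu k).eq_or_lt with h0 | h0
  · refine ⟨1, one_pos, ?_⟩
    rintro r ⟨-, ε, hε, h⟩
    have h1 := h k
    rw [← hk, PiLp.smul_apply, ← h0, smul_zero] at h1
    nlinarith [mul_nonneg (hε k).1 hpos.le]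
  · refine ⟨v k / u k, div_pos hpos h0, ?_⟩
    rintro r ⟨-, ε, hε, h⟩
    have h1 := h k
    rw [← hk, PiLp.smul_apply, smul_eq_mul] at h1
    constructor
    · rw [div_le_iff₀ h0]
      nlinarith [mul_nonneg (hε k).1 hpos.le]
    · rw [div_mul_eq_mul_div, le_div_iff₀ h0]
      nlinarith [mul_le_mul_of_nonneg_right (hε k).2 hpos.le]


/-- For a nonnegative unit direction `u` and a nonnegative `v ≠ 0`, the set `S` of radii
`r > 0` with `r • u` a Square-Shift perturbation of `v` satisfies
`∫₀^∞ (1/r)·1_S(r) dr ≤ ln(1+δ)`. -/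
theorem stmt12 (m : ℕ) (hm : 1 ≤ m) (δ : ℝ) (hδ : 0 < δ)
    (u : EuclideanSpace ℝ (Fin m)) (hu : ∀ j, 0 ≤ u j) (hunorm : ‖u‖ = 1)
    (v : EuclideanSpace ℝ (Fin m)) (hv : ∀ j, 0 ≤ v j) (hv0 : v ≠ 0) :
    ∫⁻ r in Set.Ioi (0:ℝ),
        Set.indicator {r : ℝ | 0 < r ∧ sqShift δ v (r • u)}
          (fun r => ENNReal.ofReal (1/r)) r
      ≤ ENNReal.ofReal (Real.log (1+δ)) := by
  obtain ⟨a, ha, hS⟩ := exists_sqShift_radii_subset_Icc δ u v hu hv hv0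
  calc _ ≤ ∫⁻ r, Set.indicator {r : ℝ | 0 < r ∧ sqShift δ v (r • u)}
          (fun r => ENNReal.ofReal (1 / r)) r := MeasureTheory.setLIntegral_le_lintegral _ _
    _ ≤ ∫⁻ r, (Set.Icc a (a * (1 + δ))).indicator (fun r => ENNReal.ofReal (1 / r)) r :=
        MeasureTheory.lintegral_mono
          (Set.indicator_le_indicator_of_subset hS fun _ => zero_le)
    _ = ENNReal.ofReal (Real.log (1 + δ)) := by
        rw [MeasureTheory.lintegral_indicator measurableSet_Icc,
          setLIntegral_Icc_one_div_eq_log ha (by linarith)]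
end

section
/- Let X be a real-valued random variable with 0 ≤ X ≤ 2 almost surely, and let B ∈ (0, 2] be such that for every x ≥ B, P(X ≥ x) ≤ B/x. Then E[X] ≤ B + B·ln(2/B). -/
open MeasureTheory

/-- If `0 ≤ X ≤ 2` almost surely and `P(X ≥ x) ≤ B/x` for all `x ≥ B` (with
`B ∈ (0, 2]`), then `E[X] ≤ B + B·ln(2/B)`. -/
theorem stmt17 {Ω : Type*} [MeasurableSpace Ω] (μ : Measure Ω) [IsProbabilityMeasure μ]
    (X : Ω → ℝ) (hX : AEMeasurable X μ)
    (hbound : ∀ᵐ ω ∂μ, X ω ∈ Set.Icc (0:ℝ) 2)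
    (B : ℝ) (hB : B ∈ Set.Ioc (0:ℝ) 2)
    (htail : ∀ x, B ≤ x → μ {ω | x ≤ X ω} ≤ ENNReal.ofReal (B / x)) :
    ∫ ω, X ω ∂μ ≤ B + B * Real.log (2 / B) := by
  obtain ⟨hB0, hB2⟩ := hB
  have hXint : Integrable X μ := Integrable.of_mem_Icc 0 2 hX hbound
  have hanti : Antitone fun t => μ.real {ω | t ≤ X ω} := fun s t hst =>
    measureReal_mono fun _ hω => hst.trans hω
  have hint (a b : ℝ) : IntervalIntegrable (fun t => μ.real {ω | t ≤ X ω}) volume a b :=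
    hanti.intervalIntegrable
  have hinv : IntervalIntegrable (fun t : ℝ => t⁻¹) volume B 2 :=
    intervalIntegrable_inv_iff.2 <| Or.inr <| by
      rw [Set.uIcc_of_le hB2]
      exact fun h => absurd h.1 hB0.not_ge
  have hlow : ∫ t in 0..B, μ.real {ω | t ≤ X ω} ≤ B := by
    simpa using intervalIntegral.integral_mono_on hB0.le (hint 0 B)
      (intervalIntegrable_const (c := (1 : ℝ))) fun _ _ => measureReal_le_one
  have hhigh : ∫ t in B..2, μ.real {ω | t ≤ X ω} ≤ B * Real.log (2 / B) := by
    rw [← integral_inv_of_pos hB0 two_pos, ← intervalIntegral.integral_const_mul]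
    refine intervalIntegral.integral_mono_on hB2 (hint B 2) (hinv.const_mul B) fun t ht => ?_
    rw [← div_eq_mul_inv]
    exact ENNReal.toReal_le_of_le_ofReal (div_nonneg hB0.le (hB0.le.trans ht.1)) (htail t ht.1)
  rw [hXint.integral_eq_integral_Ioc_meas_le (hbound.mono fun _ h => h.1)
      (hbound.mono fun _ h => h.2), ← intervalIntegral.integral_of_le two_pos.le,
    ← intervalIntegral.integral_add_adjacent_intervals (hint 0 B) (hint B 2)]
  exact add_le_add hlow hhigh
end

section
/- Let δ ≥ 0 and let (M_i)_{i≥1} be positive reals with M_{i+1} ≥ 2(1+δ)·M_i for all i ≥ 1 and Σ_{i≥1} 1/M_i ≤ 1. Let X be a real-valued random variable such that for each i ≥ 1, X takes some value w_i ∈ [0, 2(1+δ)·M_i] with probability 1/M_i, and X = 0 with the remaining probability 1 − Σ_{i≥1} 1/M_i. Then for every price p > 0, p · P(X ≥ p) ≤ 4(1+δ). -/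
open MeasureTheory

/-- A sequence of reals that at least doubles at each step from `k` on grows geometrically. -/
theorem two_pow_mul_le_of_two_mul_le {M : ℕ → ℝ} {k : ℕ}
    (h : ∀ i, k ≤ i → 2 * M i ≤ M (i + 1)) (j : ℕ) : 2 ^ j * M k ≤ M (k + j) := by
  induction j with
  | zero => simp
  | succ j ih =>
    have := h (k + j) (Nat.le_add_right k j)
    rw [pow_succ, ← add_assoc]
    linarith

/-- If the probabilities of the events `A (k + j)` decay at least geometrically with ratio `1 / 2`,
their union has measure at most twice the leading bound. -/
theorem measure_iUnion_le_two_mul_of_geometric {Ω : Type*} [MeasurableSpace Ω] (μ : Measure Ω)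
    {A : ℕ → Set Ω} {c : ℝ} (hc : 0 ≤ c)
    (hA : ∀ j, μ (A j) ≤ ENNReal.ofReal ((1 / 2) ^ j * c)) :
    μ (⋃ j, A j) ≤ ENNReal.ofReal (2 * c) := by
  calc μ (⋃ j, A j) ≤ ∑' j, μ (A j) := measure_iUnion_le A
    _ ≤ ∑' j : ℕ, ENNReal.ofReal ((1 / 2) ^ j * c) := ENNReal.tsum_le_tsum hA
    _ = ENNReal.ofReal (∑' j : ℕ, (1 / 2) ^ j * c) :=
      (ENNReal.ofReal_tsum_of_nonneg (fun j => by positivity)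
        (summable_geometric_two.mul_right c)).symm
    _ = ENNReal.ofReal (2 * c) := by rw [tsum_mul_right, tsum_geometric_two]

/-- Let `(M_i)_{i ≥ 1}` be positive reals with `M_{i+1} ≥ 2(1+δ)M_i` and
`Σ_{i≥1} 1/M_i ≤ 1`.  Suppose `X` takes, on pairwise disjoint events `A_i` of
probability `1/M_i` (`i ≥ 1`), a value `w_i ∈ [0, 2(1+δ)M_i]`, and equals `0` outside
these events.  Then for every price `p > 0`, `p · P(X ≥ p) ≤ 4(1+δ)`. -/
theorem stmt18 {Ω : Type*} [MeasurableSpace Ω] (μ : Measure Ω) [IsProbabilityMeasure μ]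
    (δ : ℝ) (hδ : 0 ≤ δ) (M w : ℕ → ℝ) (X : Ω → ℝ) (A : ℕ → Set Ω)
    (hMpos : ∀ i, 1 ≤ i → 0 < M i)
    (hgrow : ∀ i, 1 ≤ i → 2 * (1+δ) * M i ≤ M (i+1))
    (hsum : ∑' i : ℕ, 1 / M (i+1) ≤ 1)
    (hdisj : ∀ i j, 1 ≤ i → 1 ≤ j → i ≠ j → Disjoint (A i) (A j))
    (hA : ∀ i, 1 ≤ i → μ (A i) = ENNReal.ofReal (1 / M i))
    (hw : ∀ i, 1 ≤ i → w i ∈ Set.Icc (0:ℝ) (2 * (1+δ) * M i))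
    (hXA : ∀ i, 1 ≤ i → ∀ ω ∈ A i, X ω = w i)
    (hX0 : ∀ ω, (∀ i, 1 ≤ i → ω ∉ A i) → X ω = 0) :
    ∀ p : ℝ, 0 < p →
      ENNReal.ofReal p * μ {ω | p ≤ X ω} ≤ ENNReal.ofReal (4 * (1+δ)) := by
  intro p hp
  by_cases hex : ∃ i, 1 ≤ i ∧ p ≤ w i
  swap
  · have hempty : {ω | p ≤ X ω} = ∅ := by
      refine Set.eq_empty_of_forall_notMem fun ω (hω : p ≤ X ω) => ?_
      by_cases hmem : ∃ i, 1 ≤ i ∧ ω ∈ A i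
      · obtain ⟨i, hi, hωi⟩ := hmem
        exact hex ⟨i, hi, hXA i hi ω hωi ▸ hω⟩
      · push Not at hmem
        exact absurd (hX0 ω hmem ▸ hω) hp.not_ge
    simp [hempty]
  classical
  obtain ⟨k, ⟨hk, hpk⟩, hmin⟩ :
      ∃ k, (1 ≤ k ∧ p ≤ w k) ∧ ∀ i, 1 ≤ i → p ≤ w i → k ≤ i :=
    ⟨Nat.find hex, Nat.find_spec hex, fun i hi hpi => Nat.find_min' hex ⟨hi, hpi⟩⟩
  have hMk := hMpos k hk
  have hsub : {ω | p ≤ X ω} ⊆ ⋃ j, A (k + j) := by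
    intro ω (hω : p ≤ X ω)
    by_cases hmem : ∃ i, 1 ≤ i ∧ ω ∈ A i
    · obtain ⟨i, hi, hωi⟩ := hmem
      obtain ⟨j, rfl⟩ := Nat.exists_eq_add_of_le (hmin i hi (hXA i hi ω hωi ▸ hω))
      exact Set.mem_iUnion.2 ⟨j, hωi⟩
    · push Not at hmem
      exact absurd (hX0 ω hmem ▸ hω) hp.not_ge
  have hdouble : ∀ i, k ≤ i → 2 * M i ≤ M (i + 1) := fun i hi => by
    have := hgrow i (hk.trans hi)
    nlinarith [mul_nonneg hδ (hMpos i (hk.trans hi)).le]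
  have htail : μ (⋃ j, A (k + j)) ≤ ENNReal.ofReal (2 * (1 / M k)) := by
    refine measure_iUnion_le_two_mul_of_geometric μ (by positivity) fun j => ?_
    rw [hA (k + j) (hk.trans (Nat.le_add_right k j))]
    refine ENNReal.ofReal_le_ofReal ?_
    rw [one_div_pow, one_div_mul_one_div]
    exact one_div_le_one_div_of_le (by positivity) (two_pow_mul_le_of_two_mul_le hdouble j)
  calc ENNReal.ofReal p * μ {ω | p ≤ X ω}
      ≤ ENNReal.ofReal p * ENNReal.ofReal (2 * (1 / M k)) := by
        gcongr
        exact (measure_mono hsub).trans htail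
    _ = ENNReal.ofReal (p * (2 * (1 / M k))) := (ENNReal.ofReal_mul hp.le).symm
    _ ≤ ENNReal.ofReal (4 * (1+δ)) := by
        refine ENNReal.ofReal_le_ofReal ?_
        calc p * (2 * (1 / M k)) ≤ 2 * (1+δ) * M k * (2 * (1 / M k)) := by
              gcongr
              exact hpk.trans (hw k hk).2
          _ = 4 * (1+δ) := by
              field_simp
              ring
end
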